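/- arXiv:1308.1500 — 4 statements merged into one kernel-verified Lean document; each statement's English description precedes it below -/
import Mathlib

section
/- The full unitary group U(H) of an infinite-dimensional complex Hilbert space, with the norm topology, is a bounded topological group: for every norm-neighborhood U of the identity there exists m ∈ ℕ with U(H) ⊆ U^m. -/
open Pointwise

section CStarAlgebra

variable {A : Type*} [CStarAlgebra A]

open selfAdjoint

/-- A unitary whose real part is nonnegative is at distance less than `2` from `1`. -/
lemma Unitary.norm_sub_one_lt_two_of_nonneg_add_star [PartialOrder A] [StarOrderedRing A]
    (u : unitary A) (hu : 0 ≤ (u : A) + star (u : A)) : ‖(u - 1 : A)‖ < 2 := by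
  nontriviality A
  have hmul : star (u - 1 : A) * (u - 1) = 2 - (u + star (u : A)) := by
    simp only [star_sub, star_one, sub_mul, mul_sub, Unitary.coe_star_mul_self, one_mul, mul_one]
    rw [← one_add_one_eq_two]
    abel
  have hle : star (u - 1 : A) * (u - 1) ≤ 2 := hmul ▸ sub_le_self _ hu
  have hnorm : ‖(u - 1 : A)‖ * ‖(u - 1 : A)‖ ≤ 2 := calc
    _ = ‖star (u - 1 : A) * (u - 1)‖ := CStarRing.norm_star_mul_self.symm
    _ ≤ ‖(2 : A)‖ := CStarAlgebra.norm_le_norm_of_nonneg_of_le (star_mul_self_nonneg _) hle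
    _ ≤ ‖(1 : A)‖ + ‖(1 : A)‖ := by rw [← one_add_one_eq_two]; exact norm_add_le _ _
    _ = 2 := by rw [CStarRing.norm_one]; norm_num
  nlinarith

/-- The unitaries at distance less than `2` from `1` are absorbed by some power of any given
neighborhood of `1`. -/
lemma Unitary.exists_forall_norm_sub_one_lt_two_mem_pow {U : Set (unitary A)}
    (hU : U ∈ nhds (1 : unitary A)) :
    ∃ m : ℕ, ∀ u : unitary A, ‖(u - 1 : A)‖ < 2 → u ∈ U ^ m := by
  have hpre : expUnitary ⁻¹' U ∈ nhds (0 : selfAdjoint A) :=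
    continuous_expUnitary.continuousAt.preimage_mem_nhds (by rwa [expUnitary_zero])
  obtain ⟨ε, hε, hball⟩ := Metric.mem_nhds_iff.mp hpre
  obtain ⟨m, hm⟩ := exists_nat_gt (Real.pi / ε)
  have hm₀ : (0 : ℝ) < m := lt_trans (by positivity) hm
  refine ⟨m, fun u hu ↦ ?_⟩
  set a := argSelfAdjoint u
  have hpow (n : ℕ) : expUnitary (n • ((m : ℝ)⁻¹ • a)) = expUnitary ((m : ℝ)⁻¹ • a) ^ n := by
    induction n with
    | zero => simp
    | succ n ih =>
      rw [succ_nsmul, Commute.expUnitary_add, ih, pow_succ]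
      exact (Commute.refl _).smul_left n
  have hroot : expUnitary ((m : ℝ)⁻¹ • a) ^ m = u := by
    rw [← hpow, ← Nat.cast_smul_eq_nsmul ℝ, smul_inv_smul₀ hm₀.ne', expUnitary_argSelfAdjoint hu]
  rw [← hroot]
  refine Set.pow_mem_pow (hball ?_)
  rw [mem_ball_zero_iff]
  calc ‖(m : ℝ)⁻¹ • a‖ = (m : ℝ)⁻¹ * ‖a‖ := by
        change ‖(m : ℝ)⁻¹ • (a : A)‖ = _
        rw [norm_smul, norm_inv, Real.norm_natCast]; rfl
    _ ≤ (m : ℝ)⁻¹ * Real.pi := by gcongr; exact norm_argSelfAdjoint_le_pi u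
    _ < ε := by
        rw [inv_mul_lt_iff₀ hm₀]
        exact (div_lt_iff₀ hε).mp hm

end CStarAlgebra

section Hilbert

variable {H : Type*} [NormedAddCommGroup H] [InnerProductSpace ℂ H] [CompleteSpace H]

/-- The orthogonal projection onto a closed subspace commutes with every operator that leaves
the subspace invariant together with its adjoint. -/
lemma Submodule.commute_starProjection_of_mapsTo (K : Submodule ℂ H) [K.HasOrthogonalProjection]
    (T : H →L[ℂ] H) (hT : ∀ x ∈ K, T x ∈ K) (hT' : ∀ x ∈ K, star T x ∈ K) :
    Commute K.starProjection T := by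
  ext x
  refine K.eq_starProjection_of_mem_orthogonal (hT _ (K.starProjection_apply_mem x)) ?_
  intro y hy
  change inner ℂ y (T x - T (K.starProjection x)) = 0
  rw [← map_sub, ← ContinuousLinearMap.adjoint_inner_left]
  exact K.sub_starProjection_mem_orthogonal x _ (hT' y hy)

/-- A self-adjoint operator `b` admits a sign: a self-adjoint involution `S` with `0 ≤ S * b`
which commutes with everything that commutes with `b`. -/
lemma IsSelfAdjoint.exists_sign {b : H →L[ℂ] H} (hb : IsSelfAdjoint b) :
    ∃ S : H →L[ℂ] H, IsSelfAdjoint S ∧ S * S = 1 ∧ 0 ≤ S * b ∧ ∀ T, Commute b T → Commute S T := by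
  let K : Submodule ℂ H := (b⁻).ker
  have : CompleteSpace K := (b⁻).isClosed_ker.completeSpace_coe
  let P := K.starProjection
  have hP : IsSelfAdjoint P := isSelfAdjoint_starProjection K
  have hPP : P * P = P := K.isIdempotentElem_starProjection
  have hpos : P * b⁺ = b⁺ := by
    ext x
    exact K.starProjection_eq_self_iff.mpr <|
      DFunLike.congr_fun (CFC.negPart_mul_posPart b) x
  have hneg' : b⁻ * P = 0 := by
    ext x
    exact K.starProjection_apply_mem x
  have hneg : P * b⁻ = 0 := by
    have h := congrArg star hneg'
    rwa [star_mul, hP.star_eq, (CFC.negPart_nonneg b).isSelfAdjoint.star_eq, star_zero] at h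
  have hinv {T : H →L[ℂ] H} (hT : Commute b T) (x : H) (hx : x ∈ K) : T x ∈ K := by
    have hc : Commute b⁻ T := hT.cfcₙ_real _
    have h := DFunLike.congr_fun hc.eq x
    change b⁻ (T x) = T (b⁻ x) at h
    change b⁻ (T x) = 0
    rw [h, show b⁻ x = 0 from hx, map_zero]
  refine ⟨2 * P - 1, ?_, ?_, ?_, fun T hT ↦ ?_⟩
  · rw [two_mul]
    exact (hP.add hP).sub (.one _)
  · simp only [two_mul, sub_mul, mul_sub, add_mul, mul_add, hPP, one_mul, mul_one]
    abel
  · have h : (2 * P - 1) * b = b⁺ + b⁻ := by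
      conv_lhs => rw [← CFC.posPart_sub_negPart b hb]
      rw [sub_mul, mul_assoc, mul_sub, hpos, hneg, two_mul]
      simp
    rw [h]
    exact add_nonneg (CFC.posPart_nonneg b) (CFC.negPart_nonneg b)
  · have hT' : Commute b (star T) := by simpa [hb.star_eq] using hT.star_star
    have hc : Commute P T := K.commute_starProjection_of_mapsTo T (hinv hT) (hinv hT')
    rw [two_mul]
    exact (hc.add_left hc).sub_left (.one_left T)

/-- Every unitary operator is a quotient of two unitaries at distance less than `2` from `1`. -/
lemma Unitary.exists_norm_sub_one_lt_two_mul_eq (u : unitary (H →L[ℂ] H)) :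
    ∃ v w : unitary (H →L[ℂ] H), ‖(v - 1 : H →L[ℂ] H)‖ < 2 ∧ ‖(w - 1 : H →L[ℂ] H)‖ < 2 ∧
      v * w = u := by
  have hb : IsSelfAdjoint (Complex.I • (star (u : H →L[ℂ] H) - u)) := by
    simp only [IsSelfAdjoint, star_smul, star_sub, star_star, RCLike.star_def, Complex.conj_I]
    module
  obtain ⟨S, hS, hSS, hpos, hcomm⟩ := hb.exists_sign
  have hSu : Commute S u := by
    refine hcomm _ (.smul_left (.sub_left ?_ (.refl _)) _)
    simp [Commute, SemiconjBy]
  have hIS : Complex.I • S ∈ unitary (H →L[ℂ] H) := by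
    simp [Unitary.mem_iff, hS.star_eq, hSS, smul_smul]
  let w : unitary (H →L[ℂ] H) := ⟨Complex.I • S, hIS⟩
  refine ⟨u * star w, w, ?_, ?_, by simp [mul_assoc]⟩
  · refine Unitary.norm_sub_one_lt_two_of_nonneg_add_star _ ?_
    convert hpos using 1
    simp [w, hS.star_eq, mul_sub, hSu.eq, smul_sub]
    abel
  · refine Unitary.norm_sub_one_lt_two_of_nonneg_add_star _ ?_
    simp [w, hS.star_eq]

end Hilbert

/-- The full unitary group of an infinite-dimensional complex Hilbert space, with
the norm topology, is a bounded topological group: every identity neighborhood `U`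
satisfies `U(H) ⊆ U ^ m` for some `m ∈ ℕ`. -/
theorem stmt_2 {H : Type*} [NormedAddCommGroup H] [InnerProductSpace ℂ H] [CompleteSpace H]
    (hinf : ¬ FiniteDimensional ℂ H) :
    ∀ U ∈ nhds (1 : unitary (H →L[ℂ] H)), ∃ m : ℕ,
      ∀ g : unitary (H →L[ℂ] H), g ∈ U ^ m := by
  intro U hU
  obtain ⟨m, hm⟩ := Unitary.exists_forall_norm_sub_one_lt_two_mem_pow hU
  refine ⟨m + m, fun g ↦ ?_⟩
  obtain ⟨v, w, hv, hw, rfl⟩ := Unitary.exists_norm_sub_one_lt_two_mul_eq g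
  rw [pow_add]
  exact Set.mul_mem_mul (hm v hv) (hm w hw)
end

section
/- For every contraction C on a Hilbert space F (i.e., ‖C‖ ≤ 1), the block operator U_C = [[C, sqrt(1 − CC*)], [−sqrt(1 − C*C), C*]] on F ⊕ F is unitary, and the compression of U_C to the first summand equals C. -/
section CStar

variable {A : Type*} [CStarAlgebra A] [PartialOrder A] [StarOrderedRing A]

theorem one_sub_star_mul_self_nonneg {a : A} (ha : ‖a‖ ≤ 1) : 0 ≤ 1 - star a * a := by
  rw [sub_nonneg, ← CStarAlgebra.norm_le_one_iff_of_nonneg _ (star_mul_self_nonneg a),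
    CStarRing.norm_star_mul_self]
  exact mul_le_one₀ ha (norm_nonneg a) ha

theorem one_sub_mul_star_self_nonneg {a : A} (ha : ‖a‖ ≤ 1) : 0 ≤ 1 - a * star a := by
  simpa using one_sub_star_mul_self_nonneg (a := star a) (by simpa using ha)

/-- An element that intertwines the squares of two positive elements intertwines the elements. -/
theorem mul_eq_mul_of_mul_sq_eq {a s t : A} (hs : 0 ≤ s) (ht : 0 ≤ t)
    (h : a * (s * s) = t * t * a) : a * s = t * a := by
  have hs' : star s = s := (IsSelfAdjoint.of_nonneg hs).star_eq
  have ht' : star t = t := (IsSelfAdjoint.of_nonneg ht).star_eq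
  obtain ⟨y, hy⟩ : ∃ y, y = a * s - t * a := ⟨_, rfl⟩
  have hty : t * y = -(y * s) := by
    rw [hy, mul_sub, sub_mul, mul_assoc a, h]
    noncomm_ring
  have hys : star y * y * s = -(star y * t * y) := by
    rw [mul_assoc (star y) t, hty, mul_neg, neg_neg, mul_assoc]
  have hcomm : Commute (star y * y) s := by
    have := congrArg star hys
    simp only [star_mul, star_neg, star_star, hs', ht'] at this
    rw [Commute, SemiconjBy, hys, this, mul_assoc]
  have hzero : star y * y * s = 0 := by
    refine le_antisymm ?_ (hcomm.mul_nonneg (star_mul_self_nonneg y) hs)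
    rw [hys, neg_nonpos]
    exact star_left_conjugate_nonneg ht y
  have hys0 : y * s = 0 := by
    rw [← CStarRing.star_mul_self_eq_zero_iff, star_mul, mul_assoc, ← mul_assoc (star y), hzero,
      mul_zero]
  have hty0 : t * y = 0 := by rw [hty, hys0, neg_zero]
  have hyy : star y * y = s * star a * y := by
    nth_rw 1 [hy]
    rw [star_sub, star_mul, star_mul, hs', ht', sub_mul, mul_assoc (star a), hty0, mul_zero,
      sub_zero]
  have hyyy : y * (star y * y) = 0 := by
    rw [hyy, ← mul_assoc, ← mul_assoc, hys0, zero_mul, zero_mul]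
  have hyy0 : star y * y = 0 := by
    rw [← CStarRing.star_mul_self_eq_zero_iff, star_mul, star_star, mul_assoc, hyyy, mul_zero]
  rw [CStarRing.star_mul_self_eq_zero_iff] at hyy0
  exact sub_eq_zero.mp (hy ▸ hyy0)

theorem mul_sqrt_one_sub_star_mul_self {a : A} (ha : ‖a‖ ≤ 1) :
    a * CFC.sqrt (1 - star a * a) = CFC.sqrt (1 - a * star a) * a := by
  refine mul_eq_mul_of_mul_sq_eq (CFC.sqrt_nonneg _) (CFC.sqrt_nonneg _) ?_
  rw [CFC.sqrt_mul_sqrt_self _ (one_sub_star_mul_self_nonneg ha),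
    CFC.sqrt_mul_sqrt_self _ (one_sub_mul_star_self_nonneg ha)]
  noncomm_ring

/-- The Julia operator of a contraction in a C⋆-algebra is unitary. -/
theorem julia_mem_unitary {a : A} (ha : ‖a‖ ≤ 1) :
    !![a, CFC.sqrt (1 - a * star a); -CFC.sqrt (1 - star a * a), star a] ∈
      unitary (Matrix (Fin 2) (Fin 2) A) := by
  have hs := CFC.sqrt_mul_sqrt_self _ (one_sub_star_mul_self_nonneg ha)
  have ht := CFC.sqrt_mul_sqrt_self _ (one_sub_mul_star_self_nonneg ha)
  have hst := mul_sqrt_one_sub_star_mul_self ha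
  have hs' := (IsSelfAdjoint.of_nonneg (CFC.sqrt_nonneg (1 - star a * a))).star_eq
  have ht' := (IsSelfAdjoint.of_nonneg (CFC.sqrt_nonneg (1 - a * star a))).star_eq
  have hst' := congrArg star hst
  simp only [star_mul, hs', ht'] at hst'
  rw [Unitary.mem_iff]
  constructor <;> ext i j <;> fin_cases i <;> fin_cases j <;>
    simp [Matrix.mul_apply, Matrix.star_apply, Fin.sum_univ_two, hs, ht, hs', ht', hst, hst']

end CStar


/-- Unitary dilation of a contraction: for a contraction `C` on a Hilbert space `F`,
the block operator `U_C = [[C, √(1 - CC*)], [−√(1 - C*C), C*]]` on `F ⊕ F` is unitary,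
and its compression to the first summand (its `(0,0)` block) equals `C`. -/
theorem stmt_7 {F : Type*} [NormedAddCommGroup F] [InnerProductSpace ℂ F]
    [CompleteSpace F] (C : F →L[ℂ] F) (hC : ‖C‖ ≤ 1) :
    (!![C, CFC.sqrt (1 - C * star C); -CFC.sqrt (1 - star C * C), star C] ∈
        unitary (Matrix (Fin 2) (Fin 2) (F →L[ℂ] F))) ∧
      !![C, CFC.sqrt (1 - C * star C); -CFC.sqrt (1 - star C * C), star C] 0 0 = C := by
  exact ⟨julia_mem_unitary hC, rfl⟩
end

section
/- Every separable continuous unitary representation of U(H)/U_∞(H) is trivial, for H a separable infinite-dimensional complex Hilbert space. Equivalently, any norm-continuous unitary representation π of U(H) on a separable Hilbert space with U_∞(H) ⊆ ker π is trivial. -/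
section ArgSelfAdjoint

open selfAdjoint Unitary

lemma Unitary.norm_argSelfAdjoint_lt_pi_div_two {A : Type*} [CStarAlgebra A] {u : unitary A}
    (hu : ‖(u - 1 : A)‖ ≤ 1) : ‖argSelfAdjoint u‖ < Real.pi / 2 := by
  have hu2 : ‖(u - 1 : A)‖ < 2 := by linarith
  rw [norm_argSelfAdjoint hu2, Real.arccos_lt_pi_div_two]
  nlinarith [norm_nonneg (u - 1 : A)]

lemma Unitary.argSelfAdjoint_mul {A : Type*} [CStarAlgebra A] {u v : unitary A}
    (huv : Commute u v) (hu : ‖(u - 1 : A)‖ ≤ 1) (hv : ‖(v - 1 : A)‖ ≤ 1) :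
    argSelfAdjoint (u * v) = argSelfAdjoint u + argSelfAdjoint v := by
  have commute_arg {a : unitary A} {b : A} (h : Commute (a : A) b)
      (h' : Commute (star (a : A)) b) : Commute (argSelfAdjoint a : A) b := h.cfc h' _
  have h1 : Commute (u : A) v := congrArg Subtype.val huv
  have h2 : Commute (star u : A) v := congrArg Subtype.val (huv.inv_left)
  have h3 : Commute (u : A) (argSelfAdjoint v : A) :=
    (commute_arg h1.symm (by simpa using h2.star_star.symm)).symm
  have h4 : Commute (star u : A) (argSelfAdjoint v : A) := by
    have := h3.star_star
    rwa [(argSelfAdjoint v).2.star_eq] at this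
  have h5 : Commute (argSelfAdjoint u : A) (argSelfAdjoint v : A) := commute_arg h3 h4
  conv_lhs => rw [← expUnitary_argSelfAdjoint (u := u) (by linarith),
    ← expUnitary_argSelfAdjoint (u := v) (by linarith), ← h5.expUnitary_add]
  apply argSelfAdjoint_expUnitary
  linarith [norm_add_le (argSelfAdjoint u) (argSelfAdjoint v),
    norm_argSelfAdjoint_lt_pi_div_two hu, norm_argSelfAdjoint_lt_pi_div_two hv]

lemma selfAdjoint.expUnitary_nsmul {A : Type*} [CStarAlgebra A] (n : ℕ) (x : selfAdjoint A) :
    expUnitary (n • x) = expUnitary x ^ n := by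
  induction n with
  | zero => simp
  | succ n ih =>
    rw [succ_nsmul, pow_succ, ← ih]
    exact Commute.expUnitary_add (by simp)

lemma selfAdjoint.expUnitary_conj {A : Type*} [CStarAlgebra A] (w : unitary A)
    {x y : selfAdjoint A} (h : (w : A) * x = y * w) :
    expUnitary y = w * expUnitary x * w⁻¹ := by
  have hy : (y : A) = w * x * ((w⁻¹ : unitary A) : A) := by
    simp [h, mul_assoc, ← Unitary.star_eq_inv]
  ext
  let +nondep : NormedAlgebra ℚ A := .restrictScalars ℚ ℂ A
  have := NormedSpace.exp_units_conj (Unitary.toUnits w) (Complex.I • (x : A))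
  rw [← map_inv] at this
  simpa [hy] using this

end ArgSelfAdjoint

section BoundedSums

lemma summable_abs_of_abs_sum_le {I : Type*} {a : I → ℝ} {C : ℝ}
    (h : ∀ F : Finset I, |∑ i ∈ F, a i| ≤ C) : Summable fun i => |a i| := by
  refine summable_of_sum_le (c := 2 * C) (fun i => abs_nonneg _) fun F => ?_
  rw [← Finset.sum_filter_add_sum_filter_not F (fun i => 0 ≤ a i)]
  have h1 : ∑ i ∈ F with 0 ≤ a i, |a i| = ∑ i ∈ F with 0 ≤ a i, a i :=
    Finset.sum_congr rfl fun i hi => abs_of_nonneg (Finset.mem_filter.1 hi).2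
  have h2 : ∑ i ∈ F with ¬ 0 ≤ a i, |a i| = - ∑ i ∈ F with ¬ 0 ≤ a i, a i := by
    rw [← Finset.sum_neg_distrib]
    exact Finset.sum_congr rfl fun i hi => abs_of_neg (not_le.1 (Finset.mem_filter.1 hi).2)
  rw [h1, h2]
  linarith [(abs_le.1 (h {i ∈ F | 0 ≤ a i})).2, (abs_le.1 (h {i ∈ F | ¬ 0 ≤ a i})).1]

lemma exists_eq_zero_of_norm_sum_le {E : Type*} [NormedAddCommGroup E] [InnerProductSpace ℂ E]
    [CompleteSpace E] [TopologicalSpace.SeparableSpace E] {I : Type*} [Uncountable I]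
    {A : I → E →L[ℂ] E} {C : ℝ} (hA : ∀ i, IsSelfAdjoint (A i))
    (hC : ∀ F : Finset I, ‖∑ i ∈ F, A i‖ ≤ C) :
    ∃ i, A i = 0 := by
  set q : I → E → ℝ := fun i v => (A i).reApplyInnerSelf v
  have hq (v : E) : {i | q i v ≠ 0}.Countable := by
    have hs : Summable fun i => |q i v| := by
      refine summable_abs_of_abs_sum_le (C := C * ‖v‖ * ‖v‖) fun F => ?_
      have : ∑ i ∈ F, q i v = (∑ i ∈ F, A i).reApplyInnerSelf v := by
        simp [q, ContinuousLinearMap.reApplyInnerSelf, sum_inner]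
      rw [this]
      refine (RCLike.abs_re_le_norm _).trans ((norm_inner_le_norm _ _).trans ?_)
      gcongr
      exact (ContinuousLinearMap.le_opNorm _ _).trans (by gcongr; exact hC F)
    simpa [Function.support] using hs.countable_support
  obtain ⟨i, hi⟩ : ∃ i, ∀ n, q i (TopologicalSpace.denseSeq E n) = 0 := by
    by_contra! h
    refine Set.not_countable_univ (α := I) ?_
    refine (Set.countable_iUnion fun n => hq (TopologicalSpace.denseSeq E n)).mono ?_
    intro i _
    simpa using h i
  refine ⟨i, ?_⟩
  have hzero : q i = 0 := by
    refine Continuous.ext_on (TopologicalSpace.denseRange_denseSeq E)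
      (ContinuousLinearMap.reApplyInnerSelf_continuous _) continuous_const ?_
    rintro _ ⟨n, rfl⟩
    exact hi n
  have hsa := (ContinuousLinearMap.isSelfAdjoint_iff_isSymmetric.1 (hA i))
  ext1 v
  have := hsa.inner_map_self_eq_zero.1 fun v => by
    refine (hsa.coe_re_inner_apply_self v).symm.trans ?_
    exact congr((($hzero v : ℝ) : ℂ))
  exact congr($this v)

end BoundedSums

section AlmostDisjoint

lemma exists_almostDisjoint_family (ι : Type*) [Countable ι] [Infinite ι] :
    ∃ α : Set ℕ → Set ι, (∀ X, (α X).Infinite) ∧ (∀ X, (α X)ᶜ.Infinite) ∧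
      ∀ X Y, X ≠ Y → (α X ∩ α Y).Finite := by
  classical
  obtain ⟨e⟩ : Nonempty (ℕ × Finset ℕ ≃ ι) := nonempty_equiv_of_countable
  set f : Set ℕ → ℕ → ι := fun X n => e (n, {k ∈ Finset.range n | k ∈ X})
  have hf (X : Set ℕ) : (Set.range (f X)).Infinite :=
    Set.infinite_range_of_injective fun m n h => (Prod.ext_iff.1 (e.injective h)).1
  have hdisj (X Y : Set ℕ) (hXY : X ≠ Y) : (Set.range (f X) ∩ Set.range (f Y)).Finite := by
    obtain ⟨m, hm⟩ : ∃ m, ¬ (m ∈ X ↔ m ∈ Y) := by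
      by_contra! h
      exact hXY (Set.ext h)
    refine ((Set.finite_Iic m).image (f X)).subset ?_
    rintro _ ⟨⟨n, rfl⟩, k, hk⟩
    obtain ⟨rfl, h⟩ := Prod.ext_iff.1 (e.injective hk)
    refine ⟨k, ?_, rfl⟩
    by_contra! hlt
    have := Finset.ext_iff.1 h m
    simp at this hlt
    grind
  refine ⟨fun X => Set.range (f X), hf, fun X => ?_, hdisj⟩
  refine ((hf Xᶜ).sdiff (hdisj Xᶜ X (by simp))).mono ?_
  rintro i ⟨h1, h2⟩ h3
  exact h2 ⟨h1, h3⟩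

lemma exists_perm_image_eq {ι : Type*} [Countable ι] {α β : Set ι} (hα : α.Infinite)
    (hα' : αᶜ.Infinite) (hβ : β.Infinite) (hβ' : βᶜ.Infinite) :
    ∃ σ : Equiv.Perm ι, ∀ i, σ i ∈ β ↔ i ∈ α := by
  classical
  have := hα.to_subtype
  have := hα'.to_subtype
  have := hβ.to_subtype
  have := hβ'.to_subtype
  obtain ⟨e⟩ : Nonempty (α ≃ β) := nonempty_equiv_of_countable
  obtain ⟨e'⟩ : Nonempty ((αᶜ : Set ι) ≃ (βᶜ : Set ι)) := nonempty_equiv_of_countable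
  refine ⟨(Equiv.Set.sumCompl α).symm.trans ((e.sumCongr e').trans (Equiv.Set.sumCompl β)),
    fun i => ?_⟩
  by_cases hi : i ∈ α
  · simp [Equiv.Set.sumCompl_symm_apply_of_mem hi, hi]
  · have := (e' ⟨i, hi⟩).2
    simp_all [Equiv.Set.sumCompl_symm_apply_of_notMem hi, -Subtype.coe_prop]

end AlmostDisjoint

section DiagonalProjections

variable {H : Type*} [NormedAddCommGroup H] [InnerProductSpace ℂ H] [CompleteSpace H]

/-- The orthogonal projection onto a complete subspace, as a selfadjoint element. -/
noncomputable def Submodule.selfAdjointProjection (K : Submodule ℂ H) [K.HasOrthogonalProjection] :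
    selfAdjoint (H →L[ℂ] H) :=
  ⟨K.starProjection, isSelfAdjoint_starProjection K⟩

/-- The orthogonal projection onto the closed span of the basis vectors indexed by `S`. -/
noncomputable def HilbertBasis.diagProjection {ι : Type*} (b : HilbertBasis ι ℂ H) (S : Set ι) :
    selfAdjoint (H →L[ℂ] H) :=
  (Submodule.span ℂ (b '' S)).topologicalClosure.selfAdjointProjection

namespace HilbertBasis

variable {ι : Type*} (b : HilbertBasis ι ℂ H)

omit [CompleteSpace H] in
lemma clm_ext {T T' : H →L[ℂ] H} (h : ∀ i, T (b i) = T' (b i)) : T = T' := by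
  refine ContinuousLinearMap.ext_on (s := Set.range b) ?_ ?_
  · exact Submodule.dense_iff_topologicalClosure_eq_top.2 b.dense_span
  · rintro _ ⟨i, rfl⟩
    exact h i

lemma diagProjection_apply_of_mem {S : Set ι} {i : ι} (hi : i ∈ S) :
    (b.diagProjection S : H →L[ℂ] H) (b i) = b i :=
  Submodule.starProjection_eq_self_iff.2
    (Submodule.le_topologicalClosure _ (Submodule.subset_span ⟨i, hi, rfl⟩))

lemma diagProjection_apply_of_notMem {S : Set ι} {i : ι} (hi : i ∉ S) :
    (b.diagProjection S : H →L[ℂ] H) (b i) = 0 := by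
  refine (Submodule.starProjection_apply_eq_zero_iff _).2 ?_
  rw [Submodule.orthogonal_closure, Submodule.mem_orthogonal]
  intro u hu
  induction hu using Submodule.span_induction with
  | mem x hx =>
    obtain ⟨j, hj, rfl⟩ := hx
    exact b.orthonormal.2 (ne_of_mem_of_not_mem hj hi)
  | zero => simp
  | add x y _ _ hx hy => simp [inner_add_left, hx, hy]
  | smul c x _ hx => simp [inner_smul_left, hx]

lemma diagProjection_commute (S T : Set ι) :
    Commute (b.diagProjection S : H →L[ℂ] H) (b.diagProjection T : H →L[ℂ] H) := by
  refine b.clm_ext fun i => ?_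
  by_cases hS : i ∈ S <;> by_cases hT : i ∈ T <;>
    simp [diagProjection_apply_of_mem, diagProjection_apply_of_notMem, hS, hT]

lemma diagProjection_union_add_inter (S T : Set ι) :
    b.diagProjection (S ∪ T) + b.diagProjection (S ∩ T) =
      b.diagProjection S + b.diagProjection T := by
  refine Subtype.ext (b.clm_ext fun i => ?_)
  by_cases hS : i ∈ S <;> by_cases hT : i ∈ T <;>
    simp [diagProjection_apply_of_mem, diagProjection_apply_of_notMem, hS, hT]

lemma diagProjection_empty : b.diagProjection ∅ = 0 :=
  Subtype.ext (b.clm_ext fun i => by simp [diagProjection_apply_of_notMem])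

lemma norm_diagProjection_le (S : Set ι) : ‖b.diagProjection S‖ ≤ 1 :=
  Submodule.starProjection_norm_le _

/-- Permutations of a Hilbert basis are implemented by unitary operators. -/
lemma exists_unitary_perm (σ : Equiv.Perm ι) :
    ∃ w : unitary (H →L[ℂ] H), ∀ i, (w : H →L[ℂ] H) (b i) = b (σ i) := by
  classical
  have hrange : Set.range (b ∘ σ) = Set.range b := σ.surjective.range_comp b
  set b' : HilbertBasis ι ℂ H := HilbertBasis.mk (b.orthonormal.comp σ σ.injective)
    (by rw [hrange, b.dense_span])
  refine ⟨Unitary.linearIsometryEquiv.symm (b.repr.trans b'.repr.symm), fun i => ?_⟩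
  have : b'.repr.symm (b.repr (b i)) = b (σ i) := by
    rw [b.repr_self, b'.repr_symm_single]
    simp [b']
  simpa using this

lemma exists_unitary_mul_diagProjection (σ : Equiv.Perm ι) {S T : Set ι}
    (h : ∀ i, σ i ∈ T ↔ i ∈ S) :
    ∃ w : unitary (H →L[ℂ] H), (w : H →L[ℂ] H) * (b.diagProjection S : H →L[ℂ] H) =
      (b.diagProjection T : H →L[ℂ] H) * w := by
  obtain ⟨w, hw⟩ := b.exists_unitary_perm σ
  refine ⟨w, b.clm_ext fun i => ?_⟩
  by_cases hS : i ∈ S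
  · simp [hw, diagProjection_apply_of_mem, hS, (h i).2 hS]
  · simp [hw, diagProjection_apply_of_notMem, hS, mt (h i).1 hS]

omit [CompleteSpace H] in
lemma finiteDimensional_of_finite {S : Set ι} (hS : S.Finite) :
    FiniteDimensional ℂ (Submodule.span ℂ (b '' S)).topologicalClosure := by
  have : FiniteDimensional ℂ (Submodule.span ℂ (b '' S)) :=
    FiniteDimensional.span_of_finite ℂ (hS.image b)
  rwa [(Submodule.closed_of_finiteDimensional _).submodule_topologicalClosure_eq]

include b in
omit [CompleteSpace H] in
lemma countable_index [TopologicalSpace.SeparableSpace H] : Countable ι := by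
  refine Pairwise.countable_of_isOpen_disjoint (s := fun i => Metric.ball (b i) (1 / 2)) ?_
    (fun i => Metric.isOpen_ball) fun i => ⟨b i, by simp⟩
  intro i j hij
  refine Metric.ball_disjoint_ball ?_
  have h : ‖b i - b j‖ ^ 2 = 2 := by
    rw [@norm_sub_sq ℂ, b.orthonormal.1, b.orthonormal.1, b.orthonormal.2 hij]
    norm_num
  rw [dist_eq_norm]
  nlinarith [norm_nonneg (b i - b j)]

end HilbertBasis

/-- Every orthogonal projection is diagonal in a suitable Hilbert basis. -/
lemma Submodule.exists_hilbertBasis_diagProjection (K : Submodule ℂ H)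
    [CompleteSpace K] :
    ∃ (w : Set H) (b : HilbertBasis w ℂ H) (S : Set w),
      b.diagProjection S = K.selfAdjointProjection := by
  obtain ⟨s, c, hc⟩ := exists_hilbertBasis ℂ K
  have hs : Orthonormal ℂ ((↑) : ((↑) '' s : Set H) → H) := by
    have h := c.orthonormal.comp_linearIsometry K.subtypeₗᵢ
    rw [show ((↑) '' s : Set H) = Set.range (K.subtypeₗᵢ ∘ c) by simp [hc, Set.range_comp]]
    exact h.toSubtypeRange
  obtain ⟨w, b, hsw, hb⟩ := hs.exists_hilbertBasis_extension
  refine ⟨w, b, {i | (i : H) ∈ ((↑) '' s : Set H)}, Subtype.ext (b.clm_ext fun i => ?_)⟩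
  by_cases hi : (i : H) ∈ ((↑) '' s : Set H)
  · rw [b.diagProjection_apply_of_mem hi]
    obtain ⟨x, hx, hxi⟩ := hi
    refine (Submodule.starProjection_eq_self_iff.2 ?_).symm
    rw [hb, ← hxi]
    exact x.2
  · rw [b.diagProjection_apply_of_notMem hi]
    refine ((Submodule.starProjection_apply_eq_zero_iff _).2 ?_).symm
    rw [Submodule.mem_orthogonal]
    intro u hu
    have key : innerSL ℂ (b i) ∘L K.subtypeL = 0 := by
      refine ContinuousLinearMap.ext_on (s := Set.range c)
        (Submodule.dense_iff_topologicalClosure_eq_top.2 c.dense_span) ?_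
      rintro _ ⟨j, rfl⟩
      have hj : ((c j : K) : H) ∈ ((↑) '' s : Set H) := by simp [hc]
      have := b.orthonormal.2 (i := i) (j := ⟨_, hsw hj⟩) (fun h => hi (h ▸ hj))
      simpa [hb] using this
    rw [← inner_conj_symm]
    simpa using congr(starRingEnd ℂ ($key ⟨u, hu⟩))

end DiagonalProjections

section PositiveSign

open ContinuousLinearMap

variable {H : Type*} [NormedAddCommGroup H] [InnerProductSpace ℂ H] [CompleteSpace H]

lemma ContinuousLinearMap.commute_starProjection_ker {T B : H →L[ℂ] H} (hB : Commute B T)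
    (hB' : Commute (star B) T) : Commute B (LinearMap.ker T.toLinearMap).starProjection := by
  have h1 : ∀ B : H →L[ℂ] H, Commute B T → ∀ x ∈ LinearMap.ker T.toLinearMap,
      B x ∈ LinearMap.ker T.toLinearMap := by
    intro B hB x hx
    simp only [LinearMap.mem_ker, ContinuousLinearMap.coe_coe] at hx ⊢
    have := congr($(hB.eq) x)
    simp_all
  set K := LinearMap.ker T.toLinearMap
  ext x
  change B (K.starProjection x) = K.starProjection (B x)
  symm
  refine Submodule.eq_starProjection_of_mem_orthogonal (h1 B hB _ (K.starProjection_apply_mem x)) ?_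
  rw [← map_sub, Submodule.mem_orthogonal]
  intro u hu
  rw [← ContinuousLinearMap.adjoint_inner_left]
  exact (Submodule.mem_orthogonal _ _).1 (K.sub_starProjection_mem_orthogonal x) _ (h1 _ hB' u hu)

/-- A selfadjoint operator is a positive operator times a symmetry `1 - 2 • P`, where the
projection `P` commutes with every operator that doubly commutes with it. -/
lemma IsSelfAdjoint.exists_nonneg_mul {A : H →L[ℂ] H} (hA : IsSelfAdjoint A) :
    ∃ (K : Submodule ℂ H) (_ : CompleteSpace K),
      0 ≤ (1 - 2 * K.starProjection) * A ∧
      ∀ B, Commute B A → Commute (star B) A → Commute B K.starProjection := by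
  have hc (B : H →L[ℂ] H) (hB : Commute B A) : Commute B A⁺ := by
    rw [CFC.posPart_def]
    exact (hB.symm.cfcₙ_real _).symm
  set K := LinearMap.ker (A⁺ : H →L[ℂ] H).toLinearMap with hK
  have hcomp : CompleteSpace K := (A⁺ : H →L[ℂ] H).isClosed_ker.completeSpace_coe
  refine ⟨K, hcomp, ?_, fun B hB hB' => ?_⟩
  · have h1 : K.starProjection * A⁻ = A⁻ := by
      ext x
      refine Submodule.starProjection_eq_self_iff.2 ?_
      exact congr($(CFC.posPart_mul_negPart A) x)
    have h2 : A⁺ * K.starProjection = 0 := by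
      ext x
      exact K.starProjection_apply_mem x
    have h3 : K.starProjection * A⁺ = 0 := by
      have := congrArg star h2
      rwa [star_mul, (isSelfAdjoint_starProjection K).star_eq,
        (CFC.posPart_nonneg A).isSelfAdjoint.star_eq, star_zero] at this
    have h4 : (1 - 2 * K.starProjection) * A = A⁺ + A⁻ := by
      conv_lhs => rw [← CFC.posPart_sub_negPart A hA]
      linear_combination (norm := noncomm_ring) 2 * h1 - 2 * h3
    rw [h4]
    exact add_nonneg (CFC.posPart_nonneg A) (CFC.negPart_nonneg A)
  · exact commute_starProjection_ker (hc B hB) (hc _ hB')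

end PositiveSign

section OneParameter

open selfAdjoint

variable {A : Type*} [CStarAlgebra A]

/-- The one-parameter unitary group `t ↦ exp (i t x)` generated by a selfadjoint element. -/
noncomputable def selfAdjoint.unitaryGroup (x : selfAdjoint A) (t : ℝ) : unitary A :=
  expUnitary (t • x)

namespace selfAdjoint

lemma coe_unitaryGroup (x : selfAdjoint A) (t : ℝ) :
    (unitaryGroup x t : A) = NormedSpace.exp ((t * Complex.I : ℂ) • (x : A)) := by
  simp only [unitaryGroup, expUnitary_coe, selfAdjoint.val_smul]
  rw [mul_comm, mul_smul, Complex.coe_smul]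

@[simp]
lemma unitaryGroup_zero (t : ℝ) : unitaryGroup (0 : selfAdjoint A) t = 1 := by
  simp [unitaryGroup]

lemma unitaryGroup_add {x y : selfAdjoint A} (h : Commute (x : A) y) (t : ℝ) :
    unitaryGroup (x + y) t = unitaryGroup x t * unitaryGroup y t := by
  rw [unitaryGroup, smul_add]
  exact Commute.expUnitary_add ((h.smul_left t).smul_right t)

lemma commute_unitaryGroup {x y : selfAdjoint A} (h : Commute (x : A) y) (t : ℝ) :
    Commute (unitaryGroup x t) (unitaryGroup y t) :=
  Commute.expUnitary ((h.smul_left t).smul_right t)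

lemma unitaryGroup_conj (w : unitary A) {x y : selfAdjoint A} (h : (w : A) * x = y * w) (t : ℝ) :
    unitaryGroup y t = w * unitaryGroup x t * w⁻¹ :=
  expUnitary_conj w (by simp [h])

lemma unitaryGroup_div_pow (x : selfAdjoint A) (t : ℝ) {n : ℕ} (hn : n ≠ 0) :
    unitaryGroup x (t / n) ^ n = unitaryGroup x t := by
  rw [unitaryGroup, ← expUnitary_nsmul, ← Nat.cast_smul_eq_nsmul ℝ, smul_smul,
    mul_div_cancel₀ _ (Nat.cast_ne_zero.2 hn), unitaryGroup]

lemma exists_pos_forall_norm_map_unitaryGroup_sub_one_le {B : Type*} [CStarAlgebra B]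
    {π : unitary A →* unitary B} (hcont : Continuous π) :
    ∃ δ > 0, ∀ x : selfAdjoint A, ‖x‖ ≤ 1 → ∀ t : ℝ, |t| ≤ δ →
      ‖(π (unitaryGroup x t) - 1 : B)‖ ≤ 1 := by
  have h : Continuous fun x : selfAdjoint A => ‖(π (expUnitary x) - 1 : B)‖ := by fun_prop
  obtain ⟨δ, hδ, hle⟩ := Metric.continuousAt_iff.1 (h.continuousAt (x := 0)) 1 one_pos
  refine ⟨δ / 2, by positivity, fun x hx t ht => ?_⟩
  have hsmul : ‖t • x‖ ≤ δ / 2 := by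
    have : ‖t • x‖ = |t| * ‖x‖ := norm_smul t (x : A)
    rw [this]
    nlinarith [abs_nonneg t, norm_nonneg x]
  have := hle (x := t • x) (by rw [dist_zero_right]; linarith)
  simp only [expUnitary_zero, map_one, OneMemClass.coe_one, sub_self, norm_zero, dist_zero_right,
    norm_norm] at this
  exact this.le

end selfAdjoint

lemma Unitary.sum_argSelfAdjoint {ι I : Type*} {α : I → Set ι}
    (hα : ∀ i j, i ≠ j → (α i ∩ α j).Finite) {μ : Set ι → unitary A}
    (hempty : μ ∅ = 1) (hcomm : ∀ S T, Commute (μ S) (μ T))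
    (hmul : ∀ S T, (S ∩ T).Finite → μ (S ∪ T) = μ S * μ T)
    (hnorm : ∀ S, ‖(μ S - 1 : A)‖ ≤ 1) (F : Finset I) :
    ∑ i ∈ F, argSelfAdjoint (μ (α i)) = argSelfAdjoint (μ (⋃ i ∈ F, α i)) := by
  classical
  induction F using Finset.induction_on with
  | empty =>
    have := argSelfAdjoint_expUnitary (A := A) (x := 0) (by simp [Real.pi_pos])
    simpa [hempty] using this.symm
  | insert a F ha ih =>
    rw [Finset.sum_insert ha, ih, ← argSelfAdjoint_mul (hcomm _ _) (hnorm _) (hnorm _), ← hmul,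
      Finset.set_biUnion_insert]
    rw [Set.inter_iUnion₂]
    exact F.finite_toSet.biUnion fun i hi => hα a i (ne_of_mem_of_not_mem hi ha).symm

end OneParameter

section Projections

open selfAdjoint Unitary

lemma NormedSpace.exp_smul_of_isIdempotentElem {A : Type*} [NormedRing A] [NormedAlgebra ℂ A]
    [CompleteSpace A] {p : A} (hp : IsIdempotentElem p) (z : ℂ) :
    NormedSpace.exp (z • p) = 1 + (Complex.exp z - 1) • p := by
  let +nondep : NormedAlgebra ℚ A := .restrictScalars ℚ ℂ A
  have h1 : SemiconjBy p (z • p) (algebraMap ℂ A z) := by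
    rw [SemiconjBy, mul_smul_comm, hp.eq, Algebra.smul_def]
  have h2 : SemiconjBy (1 - p) (z • p) 0 := by
    simp [SemiconjBy, sub_mul, hp.eq]
  have h3 := h1.exp_right.eq
  have h4 := h2.exp_right.eq
  rw [NormedSpace.exp_zero, one_mul] at h4
  rw [← NormedSpace.algebraMap_exp_comm, ← Algebra.smul_def, ← Complex.exp_eq_exp_ℂ] at h3
  calc NormedSpace.exp (z • p)
      = p * NormedSpace.exp (z • p) + (1 - p) * NormedSpace.exp (z • p) := by
        rw [← add_mul]; simp
    _ = 1 + (Complex.exp z - 1) • p := by rw [h3, h4, sub_smul, one_smul]; abel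

variable {H : Type*} [NormedAddCommGroup H] [InnerProductSpace ℂ H] [CompleteSpace H]

lemma Submodule.coe_unitaryGroup_selfAdjointProjection (K : Submodule ℂ H)
    [K.HasOrthogonalProjection] (t : ℝ) :
    (unitaryGroup K.selfAdjointProjection t : H →L[ℂ] H) =
      1 + (Complex.exp (t * Complex.I) - 1) • K.starProjection := by
  rw [← NormedSpace.exp_smul_of_isIdempotentElem K.isIdempotentElem_starProjection]
  exact coe_unitaryGroup _ _

lemma Submodule.isCompactOperator_unitaryGroup_sub_one (K : Submodule ℂ H)
    [FiniteDimensional ℂ K] (t : ℝ) :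
    IsCompactOperator ⇑((unitaryGroup K.selfAdjointProjection t : H →L[ℂ] H) - 1) := by
  rw [K.coe_unitaryGroup_selfAdjointProjection, add_sub_cancel_left]
  have : ProperSpace K := FiniteDimensional.proper ℂ K
  have h : IsCompactOperator K.starProjection :=
    (isCompactOperator_of_locallyCompactSpace_rng K.subtypeL).comp_clm K.orthogonalProjectionOnto
  exact h.smul _

end Projections

section AlmostDisjointArgument

open selfAdjoint Unitary

lemma exists_map_eq_one_of_almostDisjoint {E : Type*} [NormedAddCommGroup E]
    [InnerProductSpace ℂ E] [CompleteSpace E] [TopologicalSpace.SeparableSpace E]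
    {ι : Type*} {I : Type*} [Uncountable I] (α : I → Set ι)
    (hα : ∀ i j, i ≠ j → (α i ∩ α j).Finite) (μ : Set ι → unitary (E →L[ℂ] E))
    (hempty : μ ∅ = 1) (hcomm : ∀ S T, Commute (μ S) (μ T))
    (hmul : ∀ S T, (S ∩ T).Finite → μ (S ∪ T) = μ S * μ T)
    (hnorm : ∀ S, ‖(μ S - 1 : E →L[ℂ] E)‖ ≤ 1) :
    ∃ i, μ (α i) = 1 := by
  obtain ⟨i, hi⟩ := exists_eq_zero_of_norm_sum_le
    (A := fun i => (argSelfAdjoint (μ (α i)) : E →L[ℂ] E)) (C := Real.pi)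
    (fun i => (argSelfAdjoint (μ (α i))).2) fun F => by
      rw [← AddSubgroup.val_finsetSum, sum_argSelfAdjoint hα hempty hcomm hmul hnorm]
      exact norm_argSelfAdjoint_le_pi (μ (⋃ i ∈ F, α i))
  refine ⟨i, ?_⟩
  replace hi : argSelfAdjoint (μ (α i)) = 0 := Subtype.ext hi
  rw [← expUnitary_argSelfAdjoint (u := μ (α i)) (by linarith [hnorm (α i)]), hi, expUnitary_zero]

variable {H : Type*} [NormedAddCommGroup H] [InnerProductSpace ℂ H] [CompleteSpace H]
  {E : Type*} [NormedAddCommGroup E] [InnerProductSpace ℂ E] [CompleteSpace E]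
  {π : unitary (H →L[ℂ] H) →* unitary (E →L[ℂ] E)}

lemma HilbertBasis.map_unitaryGroup_eq_one_of_finite
    (hker : ∀ g : unitary (H →L[ℂ] H), IsCompactOperator ⇑((g : H →L[ℂ] H) - 1) → π g = 1)
    {ι : Type*} (b : HilbertBasis ι ℂ H) {S : Set ι} (hS : S.Finite) (t : ℝ) :
    π (unitaryGroup (b.diagProjection S) t) = 1 := by
  have := b.finiteDimensional_of_finite hS
  exact hker _ (Submodule.isCompactOperator_unitaryGroup_sub_one _ t)

lemma HilbertBasis.map_unitaryGroup_mul (π : unitary (H →L[ℂ] H) →* unitary (E →L[ℂ] E))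
    {ι : Type*} (b : HilbertBasis ι ℂ H) (S T : Set ι) (t : ℝ) :
    π (unitaryGroup (b.diagProjection (S ∪ T)) t) * π (unitaryGroup (b.diagProjection (S ∩ T)) t) =
      π (unitaryGroup (b.diagProjection S) t) * π (unitaryGroup (b.diagProjection T) t) := by
  rw [← map_mul, ← map_mul, ← unitaryGroup_add (b.diagProjection_commute _ _),
    ← unitaryGroup_add (b.diagProjection_commute _ _), b.diagProjection_union_add_inter]

variable [TopologicalSpace.SeparableSpace H] [TopologicalSpace.SeparableSpace E]

lemma HilbertBasis.map_unitaryGroup_diagProjection (hcont : Continuous π)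
    (hker : ∀ g : unitary (H →L[ℂ] H), IsCompactOperator ⇑((g : H →L[ℂ] H) - 1) → π g = 1)
    {ι : Type*} (b : HilbertBasis ι ℂ H) (S : Set ι) (t : ℝ) :
    π (unitaryGroup (b.diagProjection S) t) = 1 := by
  obtain ⟨δ, hδ, hle⟩ := exists_pos_forall_norm_map_unitaryGroup_sub_one_le hcont
  have := b.countable_index
  obtain ⟨n, hn⟩ := exists_nat_gt (|t| / δ)
  have hn0 : (0 : ℝ) < n := lt_of_le_of_lt (by positivity) hn
  set s : ℝ := t / n with hs
  have hsδ : |s| ≤ δ := by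
    rw [hs, abs_div, Nat.abs_cast, div_le_iff₀ hn0]
    rw [div_lt_iff₀ hδ] at hn
    linarith
  suffices h : π (unitaryGroup (b.diagProjection S) s) = 1 by
    rw [← unitaryGroup_div_pow _ t (n := n) (by rintro rfl; simp at hn0), map_pow, h, one_pow]
  by_cases hS : S.Finite
  · exact b.map_unitaryGroup_eq_one_of_finite hker hS s
  have : Infinite ι := Set.infinite_univ_iff.1 (Set.Infinite.mono (Set.subset_univ S) hS)
  obtain ⟨α, hinf, hinf', hdisj⟩ := exists_almostDisjoint_family ι
  have hmul (S T : Set ι) (h : (S ∩ T).Finite) : π (unitaryGroup (b.diagProjection (S ∪ T)) s) =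
      π (unitaryGroup (b.diagProjection S) s) * π (unitaryGroup (b.diagProjection T) s) := by
    rw [← b.map_unitaryGroup_mul, b.map_unitaryGroup_eq_one_of_finite hker h, mul_one]
  have : Uncountable (Set ℕ) :=
    Cardinal.aleph0_lt_mk_iff.1 (by simpa using Cardinal.aleph0_lt_continuum)
  obtain ⟨X, hX⟩ := exists_map_eq_one_of_almostDisjoint α hdisj
    (fun S => π (unitaryGroup (b.diagProjection S) s)) (by simp [b.diagProjection_empty])
    (fun S T => (commute_unitaryGroup (b.diagProjection_commute S T) s).map π) hmul
    fun S => hle _ (b.norm_diagProjection_le S) s hsδ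
  have hcoinf (T : Set ι) (hT : T.Infinite) (hT' : Tᶜ.Infinite) :
      π (unitaryGroup (b.diagProjection T) s) = 1 := by
    obtain ⟨σ, hσ⟩ := exists_perm_image_eq (hinf X) (hinf' X) hT hT'
    obtain ⟨w, hw⟩ := b.exists_unitary_mul_diagProjection σ hσ
    rw [unitaryGroup_conj w hw, map_mul, map_mul, hX,
      mul_one, ← map_mul, mul_inv_cancel, map_one]
  obtain ⟨T, U, hTU, hd, hcard⟩ := Set.Infinite.exists_union_disjoint_cardinal_eq_of_infinite hS
  have hiff : T.Infinite ↔ U.Infinite := by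
    rw [← Set.infinite_coe_iff, ← Set.infinite_coe_iff, Cardinal.infinite_iff,
      Cardinal.infinite_iff, hcard]
  have hT : T.Infinite := by
    rcases Set.infinite_union.1 (hTU ▸ hS) with h | h
    exacts [h, hiff.2 h]
  have hU := hiff.1 hT
  rw [← hTU, hmul T U (by simp [hd.inter_eq]), hcoinf T hT (hU.mono hd.subset_compl_left),
    hcoinf U hU (hT.mono hd.subset_compl_right), one_mul]

lemma Submodule.map_unitaryGroup_selfAdjointProjection (hcont : Continuous π)
    (hker : ∀ g : unitary (H →L[ℂ] H), IsCompactOperator ⇑((g : H →L[ℂ] H) - 1) → π g = 1)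
    (K : Submodule ℂ H) [CompleteSpace K] (t : ℝ) :
    π (unitaryGroup K.selfAdjointProjection t) = 1 := by
  obtain ⟨w, b, S, h⟩ := K.exists_hilbertBasis_diagProjection
  rw [← h]
  exact b.map_unitaryGroup_diagProjection hcont hker S t

end AlmostDisjointArgument

section Triviality

open selfAdjoint Unitary

lemma norm_sub_algebraMap_half_le {A : Type*} [CStarAlgebra A] [PartialOrder A]
    [StarOrderedRing A] {a : A} (ha : 0 ≤ a) {r : ℝ} (har : ‖a‖ ≤ r) :
    ‖a - algebraMap ℝ A (r / 2)‖ ≤ r / 2 := by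
  have hr : 0 ≤ r := (norm_nonneg a).trans har
  cases subsingleton_or_nontrivial A
  · rw [Subsingleton.elim (a - _) 0, norm_zero]
    positivity
  have hcfc : a - algebraMap ℝ A (r / 2) = cfc (fun x : ℝ => x - r / 2) a := by
    rw [cfc_sub (fun x : ℝ => x) (fun _ : ℝ => r / 2) a, cfc_id' ℝ a, cfc_const (r / 2) a]
  rw [hcfc]
  refine norm_cfc_le (by positivity) fun x hx => ?_
  have h0 := spectrum_nonneg_of_nonneg ha hx
  have h1 : x ≤ ‖a‖ := (le_abs_self x).trans (spectrum.norm_le_norm_of_mem hx)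
  rw [Real.norm_eq_abs, abs_le]
  constructor <;> linarith

lemma norm_sub_one_lt_two_of_add_star_nonneg {A : Type*} [CStarAlgebra A] [PartialOrder A]
    [StarOrderedRing A] {u : unitary A} (hu : 0 ≤ (u : A) + star (u : A)) : ‖(u - 1 : A)‖ < 2 := by
  nontriviality A
  have h1 : ‖(u : A) + star (u : A)‖ ≤ 2 := by
    refine (norm_add_le _ _).trans ?_
    rw [norm_star, CStarRing.norm_coe_unitary]
    norm_num
  have h2 : ‖(u : A) + star (u : A) - 1‖ ≤ 1 := by simpa using norm_sub_algebraMap_half_le hu h1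
  have h3 : star (u - 1 : A) * (u - 1) = 1 - ((u : A) + star (u : A) - 1) := by
    have := Unitary.star_mul_self_of_mem u.2
    rw [star_sub, star_one, sub_mul, mul_sub, this]
    noncomm_ring
  have h4 : ‖(u - 1 : A)‖ * ‖(u - 1 : A)‖ ≤ 2 := by
    rw [← CStarRing.norm_star_mul_self, h3]
    refine (norm_sub_le _ _).trans ?_
    rw [CStarRing.norm_one]
    linarith
  nlinarith [norm_nonneg (u - 1 : A)]

/-- Halving step: a selfadjoint element which becomes nonnegative after multiplication by a
commuting symmetry `s` differs from `(‖a‖ / 2) • s` by an element of norm at most `‖a‖ / 2`. -/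
lemma norm_sub_smul_symmetry_le {A : Type*} [CStarAlgebra A] [PartialOrder A]
    [StarOrderedRing A] {a s : A} (hs : IsSelfAdjoint s) (hss : s * s = 1)
    (ha : 0 ≤ s * a) : ‖a - (‖a‖ / 2) • s‖ ≤ ‖a‖ / 2 := by
  have hu : s ∈ unitary A := by simp [Unitary.mem_iff, hs.star_eq, hss]
  have h1 : ‖s * a‖ = ‖a‖ := CStarRing.norm_mem_unitary_mul a hu
  rw [← CStarRing.norm_mem_unitary_mul _ hu, mul_sub, mul_smul_comm, hss,
    ← Algebra.algebraMap_eq_smul_one]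
  exact norm_sub_algebraMap_half_le ha h1.le

lemma exists_expUnitary_eq_mul {A : Type*} [CStarAlgebra A] [PartialOrder A]
    [StarOrderedRing A] {x p e : selfAdjoint A} (he : (e : A) = 1)
    (hp : IsIdempotentElem (p : A)) (hpx : Commute (x : A) p) (hx : 0 ≤ (1 - 2 * (p : A)) * x) :
    ∃ y : selfAdjoint A, ‖(y : A)‖ ≤ ‖(x : A)‖ / 2 ∧
      expUnitary x =
        expUnitary y * (unitaryGroup e (‖(x : A)‖ / 2) * unitaryGroup p (-‖(x : A)‖)) := by
  set r := ‖(x : A)‖ with hr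
  have hs : IsSelfAdjoint (1 - 2 * (p : A)) := by
    rw [two_mul]
    exact (IsSelfAdjoint.one _).sub (p.2.add p.2)
  have hss : (1 - 2 * (p : A)) * (1 - 2 * (p : A)) = 1 := by
    linear_combination (norm := noncomm_ring) 4 * hp.eq
  set z : selfAdjoint A := (r / 2) • e + (-r) • p with hz
  have hzc : (z : A) = (r / 2) • (1 - 2 * (p : A)) := by
    rw [hz, AddSubgroup.coe_add, selfAdjoint.val_smul, selfAdjoint.val_smul, he, smul_sub, two_mul,
      ← two_smul ℝ (p : A), smul_smul, div_mul_cancel₀ _ two_ne_zero, neg_smul, sub_eq_add_neg]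
  have hxz : Commute (x : A) z := by
    rw [hzc]
    exact ((Commute.one_right _).sub_right ((Commute.ofNat_right _ 2).mul_right hpx)).smul_right _
  refine ⟨x - z, ?_, ?_⟩
  · rw [AddSubgroup.coe_sub, hzc]
    exact norm_sub_smul_symmetry_le hs hss hx
  · have hep : Commute (((r / 2) • e : selfAdjoint A) : A) ((-r) • p : selfAdjoint A) := by
      rw [selfAdjoint.val_smul, selfAdjoint.val_smul, he]
      exact ((Commute.one_left _).smul_left _).smul_right _
    have hxzz : Commute ((x - z : selfAdjoint A) : A) z := by
      rw [AddSubgroup.coe_sub]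
      exact hxz.sub_left (Commute.refl _)
    rw [unitaryGroup, unitaryGroup, ← Commute.expUnitary_add hep, ← hz,
      ← Commute.expUnitary_add hxzz, sub_add_cancel]

variable {H : Type*} [NormedAddCommGroup H] [InnerProductSpace ℂ H] [CompleteSpace H]

lemma Submodule.coe_selfAdjointProjection_top :
    ((⊤ : Submodule ℂ H).selfAdjointProjection : H →L[ℂ] H) = 1 :=
  Submodule.starProjection_top

variable {G : Type*} [Group G] {π : unitary (H →L[ℂ] H) →* G}

lemma exists_norm_le_half_of_projections
    (hproj : ∀ (K : Submodule ℂ H) [CompleteSpace K] (t : ℝ),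
      π (unitaryGroup K.selfAdjointProjection t) = 1)
    (x : selfAdjoint (H →L[ℂ] H)) :
    ∃ y : selfAdjoint (H →L[ℂ] H), ‖(y : H →L[ℂ] H)‖ ≤ ‖(x : H →L[ℂ] H)‖ / 2 ∧
      π (expUnitary y) = π (expUnitary x) := by
  have : CompleteSpace (⊤ : Submodule ℂ H) := isClosed_univ.completeSpace_coe
  obtain ⟨K, hK, hpos, hcomm⟩ := x.2.exists_nonneg_mul
  have hxc : Commute (star (x : H →L[ℂ] H)) x := by rw [x.2.star_eq]
  obtain ⟨y, hy, hxy⟩ := exists_expUnitary_eq_mul (x := x) (p := K.selfAdjointProjection)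
    Submodule.coe_selfAdjointProjection_top K.isIdempotentElem_starProjection
    (hcomm _ (Commute.refl _) hxc) hpos
  exact ⟨y, hy, by rw [hxy, map_mul, map_mul, hproj, hproj, mul_one, mul_one]⟩

lemma exists_norm_sub_one_lt_two_of_projections
    (hproj : ∀ (K : Submodule ℂ H) [CompleteSpace K] (t : ℝ),
      π (unitaryGroup K.selfAdjointProjection t) = 1)
    (u : unitary (H →L[ℂ] H)) :
    ∃ v : unitary (H →L[ℂ] H), ‖(v - 1 : H →L[ℂ] H)‖ < 2 ∧ π v = π u := by
  have : CompleteSpace (⊤ : Submodule ℂ H) := isClosed_univ.completeSpace_coe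
  set U : H →L[ℂ] H := (u : H →L[ℂ] H)
  have hUU : Commute U (star U) := by
    rw [Commute, SemiconjBy, Unitary.mul_star_self_of_mem u.2, Unitary.star_mul_self_of_mem u.2]
  set B : H →L[ℂ] H := Complex.I • (star U - U) with hB
  have hBs : IsSelfAdjoint B := by
    rw [IsSelfAdjoint, hB, star_smul, star_sub, star_star, Complex.star_def, Complex.conj_I,
      neg_smul, ← smul_neg, neg_sub]
  have hUB : Commute U B := (hUU.sub_right (Commute.refl _)).smul_right _
  have hUB' : Commute (star U) B := ((Commute.refl _).sub_right hUU.symm).smul_right _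
  obtain ⟨K, hK, hpos, hcomm⟩ := hBs.exists_nonneg_mul
  have hKU : Commute U K.starProjection := hcomm _ hUB hUB'
  have hKs := isSelfAdjoint_starProjection K
  refine ⟨u * (unitaryGroup (⊤ : Submodule ℂ H).selfAdjointProjection (-(Real.pi / 2)) *
    unitaryGroup K.selfAdjointProjection Real.pi), ?_, ?_⟩
  · have hv : ((u * (unitaryGroup (⊤ : Submodule ℂ H).selfAdjointProjection (-(Real.pi / 2)) *
        unitaryGroup K.selfAdjointProjection Real.pi) : unitary (H →L[ℂ] H)) : H →L[ℂ] H) =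
        (-Complex.I) • ((1 - 2 * K.starProjection) * U) := by
      have h1 : Complex.exp ((-(Real.pi / 2) : ℝ) * Complex.I) = -Complex.I := by
        rw [Complex.ofReal_neg, Complex.ofReal_div, Complex.ofReal_ofNat, ← neg_div]
        exact Complex.exp_neg_pi_div_two_mul_I
      simp only [Submonoid.coe_mul, Submodule.coe_unitaryGroup_selfAdjointProjection,
        Submodule.starProjection_top, Complex.exp_pi_mul_I]
      rw [h1]
      have h2 : (1 : H →L[ℂ] H) + (-Complex.I - 1) • ContinuousLinearMap.id ℂ H =
          (-Complex.I) • 1 := by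
        change (1 : H →L[ℂ] H) + (-Complex.I - 1) • 1 = _
        module
      have h3 : (1 : H →L[ℂ] H) + (-1 - 1 : ℂ) • K.starProjection = 1 - 2 * K.starProjection := by
        rw [two_mul]
        module
      rw [h2, h3, smul_mul_assoc, one_mul, mul_smul_comm]
      congr 1
      exact ((Commute.one_right _).sub_right ((Commute.ofNat_right _ 2).mul_right hKU)).eq
    apply norm_sub_one_lt_two_of_add_star_nonneg
    rw [hv]
    convert hpos using 1
    have hKU' : star U * K.starProjection = K.starProjection * star U :=
      (hcomm _ hUB' (by rwa [star_star])).eq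
    have hstar : star ((1 - 2 * K.starProjection) * U) = (1 - 2 * K.starProjection) * star U := by
      rw [star_mul, two_mul, star_sub, star_add, star_one, hKs.star_eq, mul_sub, sub_mul, mul_add,
        add_mul, hKU', mul_one, one_mul]
    rw [star_smul, hstar, hB, mul_smul_comm, mul_sub, Complex.star_def, map_neg, Complex.conj_I]
    module
  · rw [map_mul, map_mul, hproj, hproj, mul_one, mul_one]

lemma map_eq_one_of_projections [TopologicalSpace G] [T2Space G] (hcont : Continuous π)
    (hproj : ∀ (K : Submodule ℂ H) [CompleteSpace K] (t : ℝ),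
      π (unitaryGroup K.selfAdjointProjection t) = 1)
    (u : unitary (H →L[ℂ] H)) : π u = 1 := by
  obtain ⟨v, hv, hvu⟩ := exists_norm_sub_one_lt_two_of_projections hproj u
  rw [← hvu, ← expUnitary_argSelfAdjoint hv]
  set x := argSelfAdjoint v
  have hseq (n : ℕ) : ∃ y : selfAdjoint (H →L[ℂ] H),
      ‖(y : H →L[ℂ] H)‖ ≤ ‖(x : H →L[ℂ] H)‖ * (1 / 2) ^ n ∧
        π (expUnitary y) = π (expUnitary x) := by
    induction n with
    | zero => exact ⟨x, by simp, rfl⟩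
    | succ n ih =>
      obtain ⟨y, hy, hyx⟩ := ih
      obtain ⟨z, hz, hzy⟩ := exists_norm_le_half_of_projections hproj y
      exact ⟨z, by rw [pow_succ]; linarith, hzy.trans hyx⟩
  choose y hy hyx using hseq
  have hy0 : Filter.Tendsto y Filter.atTop (nhds 0) := by
    rw [tendsto_subtype_rng]
    refine squeeze_zero_norm hy ?_
    simpa using (tendsto_pow_atTop_nhds_zero_of_lt_one (r := (1 / 2 : ℝ)) (by norm_num)
      (by norm_num)).const_mul ‖(x : H →L[ℂ] H)‖
  have hlim := ((hcont.comp continuous_expUnitary).tendsto 0).comp hy0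
  simp only [Function.comp_def, hyx, expUnitary_zero, map_one] at hlim
  exact tendsto_nhds_unique tendsto_const_nhds hlim

end Triviality

/-- Pickrell's triviality theorem: every norm-continuous unitary representation of
`U(H)` (`H` a separable infinite-dimensional complex Hilbert space) on a separable
Hilbert space that kills `U_∞(H)` is trivial. Equivalently, every separable continuous
unitary representation of `U(H)/U_∞(H)` is trivial. -/
theorem stmt_13 {H : Type*} [NormedAddCommGroup H] [InnerProductSpace ℂ H]
    [CompleteSpace H] [TopologicalSpace.SeparableSpace H] (hinf : ¬ FiniteDimensional ℂ H)
    {Hπ : Type*} [NormedAddCommGroup Hπ] [InnerProductSpace ℂ Hπ]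
    [CompleteSpace Hπ] [TopologicalSpace.SeparableSpace Hπ]
    (π : unitary (H →L[ℂ] H) →* unitary (Hπ →L[ℂ] Hπ))
    (hcont : Continuous π)
    (hker : ∀ g : unitary (H →L[ℂ] H),
      IsCompactOperator ⇑((g : H →L[ℂ] H) - 1) → π g = 1) :
    ∀ g : unitary (H →L[ℂ] H), π g = 1 := by
  exact map_eq_one_of_projections hcont fun K _ t =>
    K.map_unitaryGroup_selfAdjointProjection hcont hker t
end

section
/- The orthogonal group O(H) of an infinite-dimensional real Hilbert space H, with the norm topology, is connected. -/
/-- The iteration `Y ↦ (S + Y²) / 2` started at `0`, whose limit `Y` satisfies `(1 - Y)² = 1 - S`. -/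
noncomputable def sqrtIter {A : Type*} [Ring A] [Algebra ℝ A] (S : A) : ℕ → A
  | 0 => 0
  | n + 1 => (1 / 2 : ℝ) • (S + sqrtIter S n * sqrtIter S n)

section SqrtIter

variable {A : Type*} [NormedRing A] [NormedAlgebra ℝ A] {S : A}

theorem sqrtIter_one_nonneg (n : ℕ) : 0 ≤ sqrtIter (1 : ℝ) n := by
  induction n with
  | zero => simp [sqrtIter]
  | succ n ih => simp only [sqrtIter, smul_eq_mul]; positivity

theorem sqrtIter_one_le_one (n : ℕ) : sqrtIter (1 : ℝ) n ≤ 1 := by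
  induction n with
  | zero => simp [sqrtIter]
  | succ n ih =>
    simp only [sqrtIter, smul_eq_mul]
    nlinarith [sqrtIter_one_nonneg n]

theorem norm_sqrtIter_le (hS : ‖S‖ ≤ 1) (n : ℕ) : ‖sqrtIter S n‖ ≤ sqrtIter (1 : ℝ) n := by
  induction n with
  | zero => simp [sqrtIter]
  | succ n ih =>
    simp only [sqrtIter, smul_eq_mul, norm_smul]
    rw [show ‖(1 / 2 : ℝ)‖ = 1 / 2 by norm_num]
    gcongr
    refine (norm_add_le _ _).trans (add_le_add hS ((norm_mul_le _ _).trans ?_))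
    gcongr
    exact sqrtIter_one_nonneg n

theorem norm_sqrtIter_succ_sub_le (hS : ‖S‖ ≤ 1) (n : ℕ) :
    ‖sqrtIter S (n + 1) - sqrtIter S n‖ ≤ sqrtIter (1 : ℝ) (n + 1) - sqrtIter (1 : ℝ) n := by
  induction n with
  | zero =>
    simp only [sqrtIter, mul_zero, add_zero, sub_zero, norm_smul, smul_eq_mul]
    norm_num
    linarith
  | succ n ih =>
    have h : sqrtIter S (n + 2) - sqrtIter S (n + 1) = (1 / 2 : ℝ) •
        (sqrtIter S (n + 1) * (sqrtIter S (n + 1) - sqrtIter S n)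
          + (sqrtIter S (n + 1) - sqrtIter S n) * sqrtIter S n) := by
      rw [sqrtIter, sqrtIter.eq_2 S n, ← smul_sub, ← sqrtIter.eq_2 S n]
      congr 1
      noncomm_ring
    have h' : sqrtIter (1 : ℝ) (n + 2) - sqrtIter (1 : ℝ) (n + 1) = (1 / 2 : ℝ) *
        (sqrtIter 1 (n + 1) * (sqrtIter 1 (n + 1) - sqrtIter 1 n)
          + (sqrtIter 1 (n + 1) - sqrtIter 1 n) * sqrtIter 1 n) := by
      rw [sqrtIter, sqrtIter.eq_2 1 n, ← smul_sub, ← sqrtIter.eq_2 1 n, smul_eq_mul]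
      ring
    rw [h, h', norm_smul, show ‖(1 / 2 : ℝ)‖ = 1 / 2 by norm_num]
    have h0 := (norm_nonneg _).trans ih
    have h1 := sqrtIter_one_nonneg (n + 1)
    gcongr
    refine (norm_add_le _ _).trans (add_le_add ((norm_mul_le _ _).trans ?_)
      ((norm_mul_le _ _).trans ?_))
    · gcongr
      exact norm_sqrtIter_le hS _
    · gcongr
      exact norm_sqrtIter_le hS _

/-- In a real Banach star algebra, `1 - S` with `‖S‖ ≤ 1` and `S` self-adjoint has a square root
`1 - Y` with `‖Y‖ ≤ 1` and `Y` self-adjoint, commuting with everything that commutes with `S`. -/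
theorem exists_one_sub_mul_self_eq [CompleteSpace A] [StarRing A] [StarModule ℝ A]
    [ContinuousStar A] (hS : ‖S‖ ≤ 1) (hsa : IsSelfAdjoint S) :
    ∃ Y : A, ‖Y‖ ≤ 1 ∧ IsSelfAdjoint Y ∧ (1 - Y) * (1 - Y) = 1 - S ∧
      ∀ T, Commute S T → Commute Y T := by
  have hsum : Summable fun n ↦ sqrtIter (1 : ℝ) (n + 1) - sqrtIter (1 : ℝ) n := by
    refine summable_of_sum_range_le (c := 1)
      (fun n ↦ (norm_nonneg _).trans (norm_sqrtIter_succ_sub_le hS n)) fun n ↦ ?_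
    rw [Finset.sum_range_sub]
    simpa [sqrtIter] using sqrtIter_one_le_one n
  obtain ⟨Y, hY⟩ := cauchySeq_tendsto_of_complete <|
    cauchySeq_of_dist_le_of_summable (f := sqrtIter S) _
      (fun n ↦ by rw [dist_comm, dist_eq_norm]; exact norm_sqrtIter_succ_sub_le hS n) hsum
  have hfix : Y = (1 / 2 : ℝ) • (S + Y * Y) :=
    tendsto_nhds_unique (hY.comp (Filter.tendsto_add_atTop_nat 1))
      (((tendsto_const_nhds (x := S)).add (hY.mul hY)).const_smul (1 / 2 : ℝ))
  refine ⟨Y, ?_, ?_, ?_, fun T hT ↦ ?_⟩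
  · exact le_of_tendsto hY.norm (.of_forall fun n ↦
      (norm_sqrtIter_le hS n).trans (sqrtIter_one_le_one n))
  · refine tendsto_nhds_unique hY.star (hY.congr fun n ↦ ?_)
    induction n with
    | zero => simp [sqrtIter]
    | succ n ih =>
      rw [sqrtIter, star_smul, star_add, star_mul, ← ih, hsa.star_eq, star_trivial]
  · have h2 : Y + Y = S + Y * Y := by
      conv_lhs => rw [hfix]
      rw [← add_smul]; norm_num
    calc (1 - Y) * (1 - Y) = 1 - (Y + Y) + Y * Y := by noncomm_ring
      _ = 1 - S := by rw [h2]; abel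
  · refine tendsto_nhds_unique (hY.mul_const T) ((hY.const_mul T).congr fun n ↦ ?_)
    suffices h : Commute (sqrtIter S n) T from h.eq.symm
    induction n with
    | zero => simp [sqrtIter]
    | succ n ih => exact (hT.add_left (ih.mul_left ih)).smul_left _

end SqrtIter

section Operators

variable {H : Type*} [NormedAddCommGroup H] [InnerProductSpace ℝ H] [CompleteSpace H]

/-- The projection `P` onto the kernel of `D` satisfies `D P = 0`, and `P T = T` whenever `D T = 0`. -/
theorem exists_kernel_projection (D : H →L[ℝ] H) :
    ∃ K : Submodule ℝ H, ∃ _ : CompleteSpace K, D * K.starProjection = 0 ∧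
      ∀ T : H →L[ℝ] H, D * T = 0 → K.starProjection * T = T := by
  have hK : IsClosed (LinearMap.ker D.toLinearMap : Set H) := D.isClosed_ker
  refine ⟨LinearMap.ker D.toLinearMap, hK.completeSpace_coe, ?_, fun T hT ↦ ?_⟩
  · ext x
    exact LinearMap.mem_ker.1
      (Submodule.starProjection_apply_mem (LinearMap.ker D.toLinearMap) x)
  · ext x
    exact Submodule.starProjection_eq_self_iff.2 (LinearMap.mem_ker.2 congr($hT x))

theorem mem_connectedComponentOfOne_of_path {A : Type*} [NormedRing A] [StarRing A]
    [ContinuousStar A] {f : ℝ → A} (hf : ContinuousOn f (Set.Icc 0 1))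
    (hu : ∀ t ∈ Set.Icc (0 : ℝ) 1, f t ∈ unitary A) (h0 : f 0 = 1) {g : unitary A}
    (h1 : f 1 = g) : g ∈ Subgroup.connectedComponentOfOne (unitary A) := by
  let F : Set.Icc (0 : ℝ) 1 → unitary A := fun t ↦ ⟨f t, hu t t.2⟩
  have hF : Continuous F := (continuousOn_iff_continuous_domRestrict.1 hf).subtype_mk _
  refine (isPreconnected_range hF).subset_connectedComponent
    ⟨⟨0, by simp⟩, Subtype.ext h0⟩ ⟨⟨1, by simp⟩, Subtype.ext h1⟩

/-- The Cayley transform connects an orthogonal operator with nonnegative symmetric part to `1`. -/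
theorem mem_connectedComponentOfOne_of_inner_nonneg (u : unitary (H →L[ℝ] H))
    (hu : ∀ x, 0 ≤ inner ℝ ((u : H →L[ℝ] H) x) x) :
    u ∈ Subgroup.connectedComponentOfOne (unitary (H →L[ℝ] H)) := by
  obtain ⟨u, hmem⟩ := u
  simp only at hu
  obtain ⟨huu, huu'⟩ := Unitary.mem_iff.1 hmem
  let D : ℝ → H →L[ℝ] H := fun t ↦ (1 + t) • 1 + (1 - t) • u
  let N : ℝ → H →L[ℝ] H := fun t ↦ (1 - t) • 1 + (1 + t) • u
  have hD : ∀ t ∈ Set.Icc (0 : ℝ) 1, IsUnit (D t) := by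
    rintro t ⟨ht0, ht1⟩
    refine ContinuousLinearMap.isUnit_of_forall_le_norm_inner_map _ one_pos fun x ↦ ?_
    have : inner ℝ (D t x) x = (1 + t) * ‖x‖ ^ 2 + (1 - t) * inner ℝ (u x) x := by
      simp [D, inner_add_left, inner_smul_left]
    rw [this, Real.norm_eq_abs]
    refine le_trans ?_ (le_abs_self _)
    have h1 := mul_nonneg (sub_nonneg.2 ht1) (hu x)
    have h2 := mul_nonneg ht0 (sq_nonneg ‖x‖)
    simp only [NNReal.coe_one]
    linarith
  have hND : ∀ t, Commute (N t) (D t) := fun t ↦ by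
    have h1 : Commute (1 : H →L[ℝ] H) (D t) := Commute.one_left _
    have h2 : Commute u (D t) :=
      ((Commute.one_right u).smul_right _).add_right ((Commute.refl u).smul_right _)
    exact (h1.smul_left _).add_left (h2.smul_left _)
  have hstar : ∀ t, star (N t) * N t = star (D t) * D t := fun t ↦ by
    simp only [N, D, star_add, star_smul, star_one, star_trivial, mul_add, add_mul, smul_mul_smul,
      huu, mul_one, one_mul]
    module
  have hstar' : ∀ t, N t * star (N t) = D t * star (D t) := fun t ↦ by
    simp only [N, D, star_add, star_smul, star_one, star_trivial, mul_add, add_mul, smul_mul_smul,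
      huu', mul_one, one_mul]
    module
  refine mem_connectedComponentOfOne_of_path (f := fun t ↦ N t * Ring.inverse (D t))
    ?_ (fun t ht ↦ ?_) ?_ ?_
  · have hDc : Continuous D := by fun_prop
    have hNc : Continuous N := by fun_prop
    refine hNc.continuousOn.mul fun t ht ↦ ?_
    obtain ⟨d, hd⟩ := hD t ht
    exact (ContinuousAt.comp (g := Ring.inverse)
      (hd ▸ NormedRing.inverse_continuousAt d) hDc.continuousAt).continuousWithinAt
  · obtain ⟨d, hd⟩ := hD t ht
    have hc := hND t
    have h1 := hstar t
    have h2 := hstar' t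
    rw [← hd] at hc h1 h2
    have hs : star (↑d⁻¹ : H →L[ℝ] H) * star (d : H →L[ℝ] H) = 1 := by rw [← star_mul]; simp
    have hs' : star (d : H →L[ℝ] H) * star (↑d⁻¹ : H →L[ℝ] H) = 1 := by rw [← star_mul]; simp
    simp only [← hd, Ring.inverse_unit]
    rw [Unitary.mem_iff]
    constructor
    · rw [star_mul, mul_assoc, ← mul_assoc _ (N t), h1, mul_assoc, Units.mul_inv, mul_one, hs]
    · rw [hc.units_inv_right.eq, star_mul, mul_assoc, ← mul_assoc (N t), h2, mul_assoc, hs',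
        mul_one, Units.inv_mul]
  · have : N 0 = D 0 := by simp [N, D]
    simp only [this]
    exact Ring.mul_inverse_cancel _ (hD 0 (by simp))
  · have hd : IsUnit (D 1) := hD 1 (by simp)
    have : N 1 = u * D 1 := by simp [N, D]
    simp only [this]
    rw [mul_assoc, Ring.mul_inverse_cancel _ hd, mul_one]

/-- If `J` is skew-adjoint with `J² = -p` and `p` a projection, then the one-parameter group
generated by `J` connects `1` with `1 - 2p`. -/
theorem mem_connectedComponentOfOne_of_mul_self_eq_neg {A : Type*} [NormedRing A]
    [NormedAlgebra ℝ A] [StarRing A] [StarModule ℝ A] [ContinuousStar A] {J p : A}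
    (hp : IsStarProjection p) (hJ : star J = -J) (hJJ : J * J = -p) (hpJ : p * J = J)
    {g : unitary A} (hg : (g : A) = 1 - (2 : ℝ) • p) :
    g ∈ Subgroup.connectedComponentOfOne (unitary A) := by
  have hJp : J * p = J := by
    have := congr(star $hpJ)
    simpa [hJ, hp.isSelfAdjoint.star_eq] using this
  have hpp : p * p = p := hp.isIdempotentElem
  refine mem_connectedComponentOfOne_of_path
    (f := fun t ↦ 1 - p + Real.cos (Real.pi * t) • p + Real.sin (Real.pi * t) • J)
    (by fun_prop) (fun t _ ↦ ?_) (by simp) ?_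
  · have h := Real.sin_sq_add_cos_sq (Real.pi * t)
    rw [Unitary.mem_iff]
    simp only [star_add, star_sub, star_one, star_smul, star_trivial, hJ,
      hp.isSelfAdjoint.star_eq, mul_add, add_mul, mul_sub, sub_mul, smul_neg,
      neg_mul, mul_neg, mul_smul_comm, smul_mul_assoc, hJJ, hpJ, hJp, hpp, one_mul, mul_one]
    constructor <;> linear_combination (norm := module) h • p
  · rw [hg]
    simp
    module

/-- An infinite-dimensional real Hilbert space carries an orthogonal complex structure. -/
theorem exists_star_eq_neg_mul_self_eq_neg_one (hinf : ¬ FiniteDimensional ℝ H) :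
    ∃ J : H →L[ℝ] H, star J = -J ∧ J * J = -1 := by
  obtain ⟨ι, b, -⟩ := exists_hilbertBasis ℝ H
  have hι : Infinite ι := by
    refine not_finite_iff_infinite.1 fun _ ↦ hinf ?_
    have := Fintype.ofFinite ι
    exact b.toOrthonormalBasis.toBasis.finiteDimensional_of_finite
  obtain ⟨e⟩ : Nonempty (ι ⊕ ι ≃ ι) := by
    rw [← Cardinal.eq, ← Cardinal.add_def]
    exact Cardinal.add_eq_self (Cardinal.aleph0_le_mk ι)
  let w : ι ⊕ ι → H := b ∘ e
  have hw : Orthonormal ℝ w := b.orthonormal.comp e e.injective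
  have hw_range : Set.range w = Set.range b := e.surjective.range_comp b
  let v : ι ⊕ ι → H := Sum.elim (w ∘ Sum.inr) (-(w ∘ Sum.inl))
  have hv : Orthonormal ℝ v := by
    classical
    rw [orthonormal_iff_ite] at hw ⊢
    rintro (i | i) (j | j) <;> simp [v, hw]
  have hspan : Submodule.span ℝ (Set.range b) ≤ Submodule.span ℝ (Set.range v) := by
    rw [← hw_range, Submodule.span_le]
    rintro _ ⟨i | i, rfl⟩
    · rw [SetLike.mem_coe, ← neg_mem_iff]
      exact Submodule.subset_span ⟨Sum.inr i, rfl⟩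
    · exact Submodule.subset_span ⟨Sum.inl i, rfl⟩
  let bw := HilbertBasis.mk hw (by rw [hw_range, b.dense_span])
  let bv := HilbertBasis.mk hv
    (b.dense_span.symm.le.trans (Submodule.topologicalClosure_mono hspan))
  let U : H ≃ₗᵢ[ℝ] H := bw.repr.trans bv.repr.symm
  have hU : ∀ i, U (w i) = v i := fun i ↦ by
    classical
    have h := bw.repr_self i
    have h' := bv.repr_symm_single i
    rw [HilbertBasis.coe_mk] at h h'
    simp only [U, LinearIsometryEquiv.trans_apply, h, h']
  let J : H →L[ℝ] H := Unitary.linearIsometryEquiv.symm U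
  have hJ : star J * J = 1 := Unitary.coe_star_mul_self (Unitary.linearIsometryEquiv.symm U)
  have hJJ : J * J = -1 := by
    refine ContinuousLinearMap.ext_on (s := Set.range w) ?_ ?_
    · rw [hw_range]
      exact Submodule.dense_iff_topologicalClosure_eq_top.2 b.dense_span
    · rintro _ ⟨i | i, rfl⟩
      · change U (U (w (Sum.inl i))) = -w (Sum.inl i)
        rw [hU]
        exact hU (Sum.inr i)
      · change U (U (w (Sum.inr i))) = -w (Sum.inr i)
        rw [hU]
        simp only [v, Sum.elim_inr, Pi.neg_apply, Function.comp_apply, map_neg]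
        exact congrArg _ (hU (Sum.inl i))
  refine ⟨J, ?_, hJJ⟩
  calc star J = -(star J * (J * J)) := by rw [hJJ]; simp
    _ = -J := by rw [← mul_assoc, hJ, one_mul]

/-- The reflection `1 - 2 P` in an infinite-dimensional closed subspace is connected to `1`. -/
theorem neg_reflection_mem_connectedComponentOfOne (K : Submodule ℝ H)
    [CompleteSpace K] (hK : ¬ FiniteDimensional ℝ K) {g : unitary (H →L[ℝ] H)}
    (hg : (g : H →L[ℝ] H) = 1 - (2 : ℝ) • K.starProjection) :
    g ∈ Subgroup.connectedComponentOfOne (unitary (H →L[ℝ] H)) := by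
  obtain ⟨J, hJ, hJJ⟩ := exists_star_eq_neg_mul_self_eq_neg_one hK
  refine mem_connectedComponentOfOne_of_mul_self_eq_neg
    (J := K.subtypeL ∘L J ∘L K.orthogonalProjectionOnto) isStarProjection_starProjection
    ?_ ?_ ?_ hg
  · rw [ContinuousLinearMap.star_eq_adjoint] at hJ ⊢
    simp only [ContinuousLinearMap.adjoint_comp, hJ, Submodule.adjoint_subtypeL,
      Submodule.adjoint_orthogonalProjectionOnto]
    ext x
    simp
  · ext x
    have h := congr($hJJ (K.orthogonalProjectionOnto x))
    simp only [mul_apply_eq_comp] at h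
    simp [h]
  · ext x
    simp

/-- Every reflection in a closed subspace of an infinite-dimensional space is connected to `1`. -/
theorem reflection_mem_connectedComponentOfOne (hinf : ¬ FiniteDimensional ℝ H)
    (K : Submodule ℝ H) [CompleteSpace K] {g : unitary (H →L[ℝ] H)}
    (hg : (g : H →L[ℝ] H) = 2 * K.starProjection - 1) :
    g ∈ Subgroup.connectedComponentOfOne (unitary (H →L[ℝ] H)) := by
  by_cases hK : FiniteDimensional ℝ K
  · refine neg_reflection_mem_connectedComponentOfOne Kᗮ (fun hK' ↦ hinf ?_) ?_
    · have h : FiniteDimensional ℝ ↥(K ⊔ Kᗮ) := inferInstance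
      rw [Submodule.sup_orthogonal_of_hasOrthogonalProjection] at h
      exact Submodule.topEquiv.finiteDimensional
    · rw [hg, Submodule.starProjection_orthogonal', two_smul]
      noncomm_ring
  · have : CompleteSpace (⊤ : Submodule ℝ H) := isClosed_univ.completeSpace_coe
    rw [← neg_neg g, ← neg_one_mul (-g)]
    refine mul_mem (neg_reflection_mem_connectedComponentOfOne ⊤ (fun h ↦ hinf ?_) ?_)
      (neg_reflection_mem_connectedComponentOfOne K hK ?_)
    · exact Submodule.topEquiv.finiteDimensional
    · rw [Submodule.starProjection_top', two_smul]
      simp [Unitary.coe_neg]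
    · rw [Unitary.coe_neg, hg, two_smul]
      noncomm_ring

/-- Every orthogonal operator becomes one with nonnegative symmetric part after multiplication by a
suitable reflection, namely the sign of its symmetric part. -/
theorem exists_reflection_mul_inner_nonneg (g : unitary (H →L[ℝ] H)) :
    ∃ K : Submodule ℝ H, ∃ _ : CompleteSpace K,
      ∀ x, 0 ≤ inner ℝ ((g * (2 * K.starProjection - 1) : H →L[ℝ] H) x) x := by
  obtain ⟨g, hmem⟩ := g
  obtain ⟨hg, hg'⟩ := Unitary.mem_iff.1 hmem
  simp only
  set c : H →L[ℝ] H := (1 / 2 : ℝ) • (g + star g) with hc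
  set s : H →L[ℝ] H := (1 / 2 : ℝ) • (g - star g) with hs
  have hcs : star c = c := by simp [hc, add_comm]
  have hss : 1 - star s * s = c * c := by
    simp only [hc, hs, star_smul, star_sub, star_star, star_trivial, smul_mul_smul, mul_add,
      add_mul, mul_sub, sub_mul, hg, hg']
    module
  have hs1 : ‖s‖ ≤ 1 := by
    have h1 : ‖g‖ ≤ 1 := ContinuousLinearMap.opNorm_le_bound _ zero_le_one fun x ↦ by
      rw [ContinuousLinearMap.norm_map_of_mem_unitary hmem, one_mul]
    rw [hs, norm_smul, show ‖(1 / 2 : ℝ)‖ = 1 / 2 by norm_num]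
    have := norm_sub_le g (star g)
    have hg1 : ‖star g‖ = ‖g‖ := norm_star g
    linarith
  have hgc : Commute c g := by
    simp only [hc, commute_iff_eq, smul_mul_assoc, mul_smul_comm, add_mul, mul_add, hg, hg']
  have hgc' : Commute c (star g) := by
    simpa [hcs] using hgc.star_star
  obtain ⟨Y, hY, hYs, hYY, hYc⟩ := exists_one_sub_mul_self_eq (S := star s * s)
    (CStarRing.norm_star_mul_self.trans_le (mul_le_one₀ hs1 (norm_nonneg _) hs1))
    (IsSelfAdjoint.star_mul_self s)
  have hYc' : ∀ T, Commute c T → Commute (1 - Y) T := fun T hT ↦ by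
    refine (Commute.one_left T).sub_left (hYc T ?_)
    rw [show star s * s = 1 - c * c by rw [← hss]; abel]
    exact (Commute.one_left T).sub_left (hT.mul_left hT)
  set R := 1 - Y with hR
  have hRs : star R = R := by simp [hR, hYs.star_eq]
  have hRc : R * c = c * R := hYc' c (Commute.refl c)
  rw [hss] at hYY
  obtain ⟨K, hK, hDP, hP⟩ := exists_kernel_projection (R - c)
  refine ⟨K, hK, ?_⟩
  set P := K.starProjection with hPdef
  have hPs : star P = P := isStarProjection_starProjection.isSelfAdjoint
  -- `P` commutes with `g` since `R - c` commutes with both `g` and `g*`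
  have hPT : ∀ T, Commute c T → P * T * P = T * P := fun T hT ↦ by
    rw [mul_assoc]
    refine hP _ ?_
    rw [← mul_assoc, ((hYc' T hT).sub_left hT).eq, mul_assoc, hDP, mul_zero]
  have hPg : P * g = g * P := by
    have h := congr(star $(hPT (star g) hgc'))
    simp only [star_mul, star_star, hPs, ← mul_assoc] at h
    rw [← h, hPT g hgc]
  have hcP : c * (2 * P - 1) = R := by
    have h1 : P * (R + c) = R + c := hP _ (by
      rw [sub_mul, mul_add, mul_add, hYY, hRc]; abel)
    have h2 : (R + c) * P = R + c := by
      simpa [hRs, hcs, hPs] using congr(star $h1)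
    rw [sub_mul, sub_eq_zero] at hDP
    rw [add_mul, hDP] at h2
    rw [mul_sub, two_mul, mul_add, h2, mul_one, add_sub_cancel_right]
  intro x
  have hsymm : inner ℝ ((g * (2 * P - 1)) x) x = inner ℝ (R x) x := by
    have h : star (g * (2 * P - 1)) = star g * (2 * P - 1) := by
      have hPg' : P * star g = star g * P := by
        simpa [hPs] using congr(star $hPg).symm
      simp only [star_mul, star_sub, hPs, star_ofNat, mul_sub, mul_one]
      rw [mul_two, two_mul, add_mul, mul_add, hPg']
    have h2 : inner ℝ ((star (g * (2 * P - 1))) x) x = inner ℝ ((g * (2 * P - 1)) x) x := by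
      rw [ContinuousLinearMap.star_eq_adjoint, ContinuousLinearMap.adjoint_inner_left,
        real_inner_comm]
    rw [h] at h2
    rw [← hcP, hc, smul_mul_assoc, add_mul, smul_apply,
      add_apply, inner_smul_left, inner_add_left, h2]
    simp
    ring
  rw [hsymm, hR, sub_apply, inner_sub_left, one_apply_eq_self,
    real_inner_self_eq_norm_sq]
  have := (real_inner_le_norm (Y x) x).trans
    (mul_le_mul_of_nonneg_right (Y.le_of_opNorm_le hY x) (norm_nonneg x))
  nlinarith

end Operators

/-- The orthogonal group `O(H)` of an infinite-dimensional real Hilbert space, with the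
norm topology, is connected. -/
theorem stmt_16 {H : Type*} [NormedAddCommGroup H] [InnerProductSpace ℝ H]
    [CompleteSpace H] (hinf : ¬ FiniteDimensional ℝ H) :
    IsConnected (unitary (H →L[ℝ] H) : Set (H →L[ℝ] H)) := by
  rw [isConnected_iff_connectedSpace, connectedSpace_iff_connectedComponent]
  refine ⟨1, Set.eq_univ_of_forall fun g ↦ ?_⟩
  change g ∈ Subgroup.connectedComponentOfOne (unitary (H →L[ℝ] H))
  obtain ⟨K, hK, h⟩ := exists_reflection_mul_inner_nonneg g
  let r : unitary (H →L[ℝ] H) :=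
    ⟨2 * K.starProjection - 1, isStarProjection_starProjection.two_mul_sub_one_mem_unitary⟩
  have hr := reflection_mem_connectedComponentOfOne hinf K (g := r) rfl
  exact (Subgroup.mul_mem_cancel_right _ hr).1
    (mem_connectedComponentOfOne_of_inner_nonneg (g * r) h)
end
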